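/- Let n ≥ 1 and let A(2n+1) = ⟨x, y ‖ (xy)ⁿ x = (yx)ⁿ y⟩ be the 2-generated Artin group. Then the center of A(2n+1) is the infinite cyclic subgroup generated by the element ((xy)ⁿ x)². -/

import Mathlib

/-- The defining relation of the 2-generated Artin group
`A(2n+1) = ⟨x, y ‖ (xy)ⁿ x = (yx)ⁿ y⟩`. -/
def artinOddRels (n : ℕ) : Set (FreeGroup (Fin 2)) :=
  {(FreeGroup.of 0 * FreeGroup.of 1) ^ n * FreeGroup.of 0 *
    ((FreeGroup.of 1 * FreeGroup.of 0) ^ n * FreeGroup.of 1)⁻¹}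

/-- The 2-generated Artin group `A(2n+1)`. -/
abbrev ArtinOdd (n : ℕ) := PresentedGroup (artinOddRels n)

open Monoid in
/-- An element of a free product of at least two groups that commutes with a nontrivial element of
every factor is trivial. -/
theorem Monoid.CoprodI.eq_one_of_commute_of {ι : Type*} [Nontrivial ι] {G : ι → Type*}
    [∀ i, Group (G i)] (g : ∀ i, G i) (hg : ∀ i, g i ≠ 1) {z : CoprodI G}
    (hz : ∀ i, Commute z (CoprodI.of (g i))) : z = 1 := by
  classical
  by_contra hne
  obtain ⟨w, rfl⟩ : ∃ w : CoprodI.Word G, w.prod = z :=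
    ⟨CoprodI.Word.equiv z, CoprodI.Word.equiv.symm_apply_apply z⟩
  have hw : w ≠ CoprodI.Word.empty := by
    rintro rfl
    exact hne CoprodI.Word.prod_empty
  obtain ⟨i, j, v, rfl⟩ := CoprodI.NeWord.of_word w hw
  obtain ⟨k, hk⟩ := exists_ne j
  let u := CoprodI.NeWord.singleton (g k) (hg k)
  let c := (v.append hk.symm u).append hk v.inv
  have hprod : c.prod = u.prod := by
    have h : v.prod * CoprodI.of (g k) = CoprodI.of (g k) * v.prod := hz k
    simp [c, u, h]
  have hword : c.toWord = u.toWord := CoprodI.Word.equiv.symm.injective hprod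
  have hlen : c.toList.length = u.toList.length :=
    congrArg (fun w : CoprodI.Word G => w.toList.length) hword
  have hpos : 0 < v.toList.length := List.length_pos_iff.2 v.toList_ne_nil
  simp [c, u] at hlen
  omega

namespace ArtinOdd

variable (n : ℕ)

/-- The product `xy` of the two standard generators. -/
def xy : ArtinOdd n := PresentedGroup.of 0 * PresentedGroup.of 1

/-- The Garside element `(xy)ⁿx`. -/
def garside : ArtinOdd n := xy n ^ n * PresentedGroup.of 0

theorem of_zero_eq : (PresentedGroup.of 0 : ArtinOdd n) = (xy n ^ n)⁻¹ * garside n := by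
  simp [garside]

theorem of_one_eq : (PresentedGroup.of 1 : ArtinOdd n) = (garside n)⁻¹ * xy n ^ (n + 1) := by
  rw [pow_succ]
  simp [garside, xy]

theorem garside_eq : garside n = PresentedGroup.of 1 * xy n ^ n := by
  have h : PresentedGroup.mk (artinOddRels n) _ = 1 :=
    PresentedGroup.one_of_mem (rels := artinOddRels n) rfl
  rw [map_mul, map_inv, mul_inv_eq_one] at h
  simp only [map_mul, map_pow] at h
  have hs : SemiconjBy (PresentedGroup.of 1 : ArtinOdd n) (xy n)
      (PresentedGroup.of 1 * PresentedGroup.of 0) := by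
    simp [SemiconjBy, xy, mul_assoc]
  exact h.trans (hs.pow_right n).eq.symm

theorem garside_sq : garside n ^ 2 = xy n ^ (2 * n + 1) := by
  calc garside n ^ 2 = garside n * (PresentedGroup.of 1 * xy n ^ n) := by
        rw [← garside_eq, sq]
    _ = xy n ^ n * xy n * xy n ^ n := by simp only [garside, xy, mul_assoc]
    _ = xy n ^ (2 * n + 1) := by rw [← pow_succ, ← pow_add]; congr 1; omega

theorem garside_sq_mem_center : garside n ^ 2 ∈ Subgroup.center (ArtinOdd n) := by
  have hg : Commute (garside n ^ 2) (garside n) := Commute.pow_self _ _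
  have hs : Commute (garside n ^ 2) (xy n) := garside_sq n ▸ Commute.pow_self _ _
  rw [Subgroup.mem_center_iff]
  intro a
  have ha := PresentedGroup.generated_by (artinOddRels n)
    (Subgroup.centralizer {garside n ^ 2}) (fun i => ?_) a
  · exact (Subgroup.mem_centralizer_singleton_iff.1 ha)
  · refine Subgroup.mem_centralizer_singleton_iff.2 (Commute.symm ?_)
    fin_cases i
    · change Commute _ (PresentedGroup.of 0)
      rw [of_zero_eq]
      exact (hs.pow_right n).inv_right.mul_right hg
    · change Commute _ (PresentedGroup.of 1)
      rw [of_one_eq]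
      exact hg.inv_right.mul_right (hs.pow_right _)

/-- The homomorphism to `ℤ` sending both generators to `1`. -/
def degree : ArtinOdd n →* Multiplicative ℤ :=
  PresentedGroup.toGroup (f := fun _ => Multiplicative.ofAdd 1) (by
    rintro _ rfl
    simp)

theorem degree_of (i : Fin 2) : degree n (PresentedGroup.of i) = Multiplicative.ofAdd 1 :=
  PresentedGroup.toGroup.of _

theorem toAdd_degree_xy : (degree n (xy n)).toAdd = 2 := by
  simp [xy, degree_of]

theorem toAdd_degree_garside : (degree n (garside n)).toAdd = 2 * n + 1 := by
  simp [garside, degree_of, toAdd_degree_xy, mul_comm (2 : ℤ)]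

theorem two_mul_dvd_toAdd_degree {a : ArtinOdd n} (ha : a ∈ Subgroup.zpowers (garside n ^ 2)) :
    2 * (2 * n + 1 : ℤ) ∣ (degree n a).toAdd := by
  obtain ⟨k, rfl⟩ := ha
  simp [toAdd_degree_garside]

instance : (Subgroup.zpowers (garside n ^ 2)).Normal :=
  ⟨fun a ha b => by
    have hc := Subgroup.zpowers_le.2 (garside_sq_mem_center n) ha
    rwa [Subgroup.mem_center_iff.1 hc b, mul_inv_cancel_right]⟩

/-- The quotient of the Artin group by the square of the Garside element. -/
abbrev CenterQuotient := ArtinOdd n ⧸ Subgroup.zpowers (garside n ^ 2)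

/-- The images of the Garside element and of `xy` in the quotient. -/
def torsion (i : Fin 2) : CenterQuotient n := ![(garside n : CenterQuotient n), xy n] i

theorem torsion_zero_sq : torsion n 0 ^ 2 = 1 :=
  (QuotientGroup.eq_one_iff (garside n ^ 2)).2 (Subgroup.mem_zpowers _)

theorem torsion_one_pow : torsion n 1 ^ (2 * n + 1) = 1 :=
  (QuotientGroup.eq_one_iff (xy n ^ (2 * n + 1))).2 (garside_sq n ▸ Subgroup.mem_zpowers _)

theorem torsion_ne_one (hn : 1 ≤ n) (i : Fin 2) : torsion n i ≠ 1 := by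
  fin_cases i
  · intro h
    have hdvd := two_mul_dvd_toAdd_degree n ((QuotientGroup.eq_one_iff (garside n)).1 h)
    rw [toAdd_degree_garside] at hdvd
    have := Int.le_of_dvd (by omega) hdvd
    omega
  · intro h
    have hdvd := two_mul_dvd_toAdd_degree n ((QuotientGroup.eq_one_iff (xy n)).1 h)
    rw [toAdd_degree_xy] at hdvd
    have := Int.le_of_dvd (by omega) hdvd
    omega

/-- The element `torsion n i`, in the cyclic subgroup it generates. -/
def cyclicGen (i : Fin 2) : Subgroup.zpowers (torsion n i) :=
  ⟨torsion n i, Subgroup.mem_zpowers _⟩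

/-- The free product of the cyclic groups generated by `torsion n 0` and `torsion n 1`. -/
abbrev CyclicCoprod := Monoid.CoprodI fun i : Fin 2 => Subgroup.zpowers (torsion n i)

/-- The image of `cyclicGen n i` in the free product. -/
def coprodGen (i : Fin 2) : CyclicCoprod n := Monoid.CoprodI.of (cyclicGen n i)

theorem coprodGen_zero_sq : coprodGen n 0 ^ 2 = 1 := by
  rw [coprodGen, ← map_pow, show cyclicGen n 0 ^ 2 = 1 from Subtype.ext (torsion_zero_sq n),
    map_one]

theorem coprodGen_one_pow : coprodGen n 1 ^ (2 * n + 1) = 1 := by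
  rw [coprodGen, ← map_pow,
    show cyclicGen n 1 ^ (2 * n + 1) = 1 from Subtype.ext (torsion_one_pow n), map_one]

/-- The homomorphism to the free product sending the Garside element and `xy` to the generators
of the two factors. -/
def toCoprod : ArtinOdd n →* CyclicCoprod n :=
  PresentedGroup.toGroup
    (f := ![(coprodGen n 1 ^ n)⁻¹ * coprodGen n 0, (coprodGen n 0)⁻¹ * coprodGen n 1 ^ (n + 1)]) (by
      rintro _ rfl
      set a := coprodGen n 0 with ha
      set b := coprodGen n 1 with hb
      have h2 : a * a = 1 := by rw [← sq, ha, coprodGen_zero_sq]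
      have hp : b ^ (n + 1) * b ^ n = 1 := by
        rw [← pow_add, hb, ← coprodGen_one_pow n]; congr 1; omega
      have hxy : (b ^ n)⁻¹ * a * (a⁻¹ * b ^ (n + 1)) = b := by simp [pow_succ]
      have hs : SemiconjBy (a⁻¹ * b ^ (n + 1)) b
          (a⁻¹ * b ^ (n + 1) * ((b ^ n)⁻¹ * a)) := by
        rw [SemiconjBy, mul_assoc _ _ (a⁻¹ * _), hxy]
      simp only [map_mul, map_inv, map_pow, FreeGroup.lift_apply_of, Matrix.cons_val_zero,
        Matrix.cons_val_one, mul_inv_eq_one]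
      rw [hxy, ← (hs.pow_right n).eq, mul_assoc a⁻¹, hp, mul_inv_cancel_left, mul_one,
        inv_eq_of_mul_eq_one_left h2])

theorem toCoprod_xy : toCoprod n (xy n) = coprodGen n 1 := by
  simp [toCoprod, xy, pow_succ]

theorem toCoprod_garside : toCoprod n (garside n) = coprodGen n 0 := by
  refine (map_mul (toCoprod n) (xy n ^ n) (PresentedGroup.of 0)).trans ?_
  rw [map_pow, toCoprod_xy]
  simp [toCoprod]

/-- The homomorphism from the free product induced by the inclusions of its factors. -/
def ofCoprod : CyclicCoprod n →* CenterQuotient n :=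
  Monoid.CoprodI.lift fun i => (Subgroup.zpowers (torsion n i)).subtype

theorem ofCoprod_coprodGen (i : Fin 2) : ofCoprod n (coprodGen n i) = torsion n i := by
  simp [ofCoprod, coprodGen, cyclicGen]

theorem ofCoprod_comp_toCoprod : (ofCoprod n).comp (toCoprod n) = QuotientGroup.mk' _ := by
  ext i
  fin_cases i
  · change ofCoprod n (toCoprod n (PresentedGroup.of 0)) =
      QuotientGroup.mk' _ (PresentedGroup.of 0)
    simp only [of_zero_eq, map_mul, map_inv, map_pow, toCoprod_xy, toCoprod_garside,
      ofCoprod_coprodGen]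
    rfl
  · change ofCoprod n (toCoprod n (PresentedGroup.of 1)) =
      QuotientGroup.mk' _ (PresentedGroup.of 1)
    simp only [of_one_eq, map_mul, map_inv, map_pow, toCoprod_xy, toCoprod_garside,
      ofCoprod_coprodGen]
    rfl

theorem center_le_zpowers (hn : 1 ≤ n) :
    Subgroup.center (ArtinOdd n) ≤ Subgroup.zpowers (garside n ^ 2) := by
  intro a ha
  have hcomm (b : ArtinOdd n) : Commute a b := (Subgroup.mem_center_iff.1 ha b).symm
  have hone : toCoprod n a = 1 := by
    refine Monoid.CoprodI.eq_one_of_commute_of (cyclicGen n)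
      (fun i h => torsion_ne_one n hn i (congrArg Subtype.val h)) fun i => ?_
    fin_cases i
    · have h := (hcomm (garside n)).map (toCoprod n)
      rwa [toCoprod_garside] at h
    · have h := (hcomm (xy n)).map (toCoprod n)
      rwa [toCoprod_xy] at h
  have h := DFunLike.congr_fun (ofCoprod_comp_toCoprod n) a
  rw [MonoidHom.comp_apply, hone, map_one] at h
  exact (QuotientGroup.eq_one_iff a).1 h.symm

theorem not_isOfFinOrder_garside_sq : ¬IsOfFinOrder (garside n ^ 2) := by
  intro h
  obtain ⟨k, hk, hpow⟩ := isOfFinOrder_iff_pow_eq_one.1 h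
  have hdeg := congrArg (fun a => (degree n a).toAdd) hpow
  simp [toAdd_degree_garside] at hdeg
  omega

end ArtinOdd

/-- For `n ≥ 1`, the center of the Artin group `A(2n+1) = ⟨x, y ‖ (xy)ⁿ x = (yx)ⁿ y⟩`
is the infinite cyclic subgroup generated by `((xy)ⁿ x)²`. -/
theorem artin_odd_center (n : ℕ) (hn : 1 ≤ n) :
    Subgroup.center (ArtinOdd n) =
      Subgroup.zpowers
        (((PresentedGroup.of 0 * PresentedGroup.of 1 : ArtinOdd n) ^ n *
            PresentedGroup.of 0) ^ 2) ∧
    ¬IsOfFinOrder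
        (((PresentedGroup.of 0 * PresentedGroup.of 1 : ArtinOdd n) ^ n *
            PresentedGroup.of 0) ^ 2) :=
  ⟨le_antisymm (ArtinOdd.center_le_zpowers n hn)
    (Subgroup.zpowers_le.2 (ArtinOdd.garside_sq_mem_center n)),
    ArtinOdd.not_isOfFinOrder_garside_sq n⟩
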